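/- Let π be the (disconnected) linear monadic datalogΟ program with the four rules G(X) ← A(X) ∧ ○D(X); D(X) ← ○D(X); D(X) ← R(X,Y) ∧ ○⁻B(Y) ∧ ○⁻D(Y); and D(X) ← A(Y) ∧ B(X), and write B₁ = A(X) ∧ ○D(X), B₂ = ○D(X), B₃ = R(X,Y) ∧ ○⁻B(Y) ∧ ○⁻D(Y). Then for all n, m ≥ 1, the composition B₁B₂^nB₃^m belongs to accept(π, G) if and only if m > n. Consequently, accept(π, G) is not a regular language over the alphabet of rule bodies of π. -/

import Mathlib

set_option linter.unusedVariables false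

open scoped Classical

/-! ## Schemas, atoms, temporal databases -/

structure Schema : Type 1 where
  Rel : Type
  arity : Rel → ℕ

def Atom (σ : Schema) (Obj : Type) : Type := Σ R : σ.Rel, (Fin (σ.arity R) → Obj)

/-- A temporal database: a finite sequence of finite slices `D_l, …, D_r`. -/
structure TemporalDB (σ : Schema) (Obj : Type) : Type where
  l : ℤ
  r : ℤ
  hle : l ≤ r
  slice : ℤ → Set (Atom σ Obj)
  support : ∀ t : ℤ, t < l ∨ r < t → slice t = ∅
  finite : ∀ t : ℤ, (slice t).Finite

namespace TemporalDB
variable {σ : Schema} {Obj : Type}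
/-- The set of objects occurring in the temporal database. -/
def Δ (D : TemporalDB σ Obj) : Set Obj := {d | ∃ t : ℤ, ∃ a ∈ D.slice t, ∃ i, a.2 i = d}
end TemporalDB

/-! ## Temporal conjunctive query bodies -/

inductive TCQ (σ : Schema) (V : Type) : Type where
  | atom (R : σ.Rel) (args : Fin (σ.arity R) → V)
  | and (φ ψ : TCQ σ V)
  | next (φ : TCQ σ V)
  | prev (φ : TCQ σ V)
  | diaF (φ : TCQ σ V)
  | diaP (φ : TCQ σ V)

namespace TCQ
variable {σ : Schema} {Obj V : Type}

def sat (D : TemporalDB σ Obj) (ν : V → Obj) : TCQ σ V → ℤ → Prop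
  | .atom R a, ℓ => D.l ≤ ℓ ∧ ℓ ≤ D.r ∧ (⟨R, fun i => ν (a i)⟩ : Atom σ Obj) ∈ D.slice ℓ
  | .and φ ψ, ℓ => sat D ν φ ℓ ∧ sat D ν ψ ℓ
  | .next φ, ℓ => sat D ν φ (ℓ + 1)
  | .prev φ, ℓ => sat D ν φ (ℓ - 1)
  | .diaF φ, ℓ => ∃ ℓ' : ℤ, ℓ < ℓ' ∧ sat D ν φ ℓ'
  | .diaP φ, ℓ => ∃ ℓ' : ℤ, ℓ' < ℓ ∧ sat D ν φ ℓ'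

/-- Number of temporal operators occurring in the body. -/
def numOps : TCQ σ V → ℕ
  | .atom _ _ => 0
  | .and φ ψ => φ.numOps + ψ.numOps
  | .next φ => φ.numOps + 1
  | .prev φ => φ.numOps + 1
  | .diaF φ => φ.numOps + 1
  | .diaP φ => φ.numOps + 1

/-- The body contains no occurrence of ◇ or ◇⁻. -/
def nextOnly : TCQ σ V → Prop
  | .atom _ _ => True
  | .and φ ψ => φ.nextOnly ∧ ψ.nextOnly
  | .next φ => φ.nextOnly
  | .prev φ => φ.nextOnly
  | .diaF _ => False
  | .diaP _ => False

/-- The set of temporalised atoms `○^k R(Z̄)` of a ◇-free body, as pairs (offset, atom). -/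
def offAtoms : TCQ σ V → ℤ → Set (ℤ × Σ R : σ.Rel, (Fin (σ.arity R) → V))
  | .atom R a, c => {(c, ⟨R, a⟩)}
  | .and φ ψ, c => φ.offAtoms c ∪ ψ.offAtoms c
  | .next φ, c => φ.offAtoms (c + 1)
  | .prev φ, c => φ.offAtoms (c - 1)
  | .diaF _, _ => ∅
  | .diaP _, _ => ∅

end TCQ

/-! ## Two-sorted first-order logic FO(<) -/

inductive FOlt (σ : Schema) : Type where
  | rel (R : σ.Rel) (args : Fin (σ.arity R) → ℕ) (t : ℕ)
  | lt (t t' : ℕ)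
  | fals
  | not (φ : FOlt σ)
  | and (φ ψ : FOlt σ)
  | or (φ ψ : FOlt σ)
  | exObj (v : ℕ) (φ : FOlt σ)
  | allObj (v : ℕ) (φ : FOlt σ)
  | exTime (v : ℕ) (φ : FOlt σ)
  | allTime (v : ℕ) (φ : FOlt σ)

/-- Truth in the two-sorted structure `𝔖_𝒟` under assignments of the object
variables (into `Δ_𝒟`) and of the temporal variables (into `tem 𝒟`). -/
def FOlt.sat {σ : Schema} {Obj : Type} (D : TemporalDB σ Obj) :
    FOlt σ → (ℕ → Obj) → (ℕ → ℤ) → Prop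
  | .rel R a t, νo, νt =>
      D.l ≤ νt t ∧ νt t ≤ D.r ∧ (⟨R, fun i => νo (a i)⟩ : Atom σ Obj) ∈ D.slice (νt t)
  | .lt t t', _, νt => νt t < νt t'
  | .fals, _, _ => False
  | .not φ, νo, νt => ¬ FOlt.sat D φ νo νt
  | .and φ ψ, νo, νt => FOlt.sat D φ νo νt ∧ FOlt.sat D ψ νo νt
  | .or φ ψ, νo, νt => FOlt.sat D φ νo νt ∨ FOlt.sat D ψ νo νt
  | .exObj v φ, νo, νt => ∃ d ∈ D.Δ, FOlt.sat D φ (Function.update νo v d) νt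
  | .allObj v φ, νo, νt => ∀ d ∈ D.Δ, FOlt.sat D φ (Function.update νo v d) νt
  | .exTime v φ, νo, νt => ∃ s : ℤ, D.l ≤ s ∧ s ≤ D.r ∧ FOlt.sat D φ νo (Function.update νt v s)
  | .allTime v φ, νo, νt => ∀ s : ℤ, D.l ≤ s → s ≤ D.r → FOlt.sat D φ νo (Function.update νt v s)
/-! ## Temporal datalog (datalogΟ) -/

/-- Temporal operators ○, ○⁻, ◇, ◇⁻. -/
inductive TOp : Type where
  | onext | oprev | diaF | diaP
deriving DecidableEq

/-- A temporalised atom `O* R(Ū)` occurring in a rule body. -/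
structure PAtom (σ : Schema) (V : Type) : Type where
  ops : List TOp
  R : σ.Rel
  args : Fin (σ.arity R) → V

def PAtom.map {σ : Schema} {V W : Type} (f : V → W) (p : PAtom σ V) : PAtom σ W :=
  ⟨p.ops, p.R, fun i => f (p.args i)⟩

/-- Satisfaction of a ground atom under a prefix of temporal operators, in a
ℤ-indexed interpretation. -/
def satOps {σ : Schema} {Obj : Type} (I : ℤ → Set (Atom σ Obj)) (a : Atom σ Obj) :
    List TOp → ℤ → Prop
  | [], ℓ => a ∈ I ℓ
  | TOp.onext :: ops, ℓ => satOps I a ops (ℓ + 1)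
  | TOp.oprev :: ops, ℓ => satOps I a ops (ℓ - 1)
  | TOp.diaF :: ops, ℓ => ∃ ℓ' : ℤ, ℓ < ℓ' ∧ satOps I a ops ℓ'
  | TOp.diaP :: ops, ℓ => ∃ ℓ' : ℤ, ℓ' < ℓ ∧ satOps I a ops ℓ'

def PAtom.sat {σ : Schema} {Obj V : Type} (I : ℤ → Set (Atom σ Obj)) (ν : V → Obj)
    (ℓ : ℤ) (p : PAtom σ V) : Prop :=
  satOps I ⟨p.R, fun i => ν (p.args i)⟩ p.ops ℓ

/-- A datalogΟ rule `C(X̄) ← O* R₁(Ū₁) ∧ … ∧ O* R_s(Ū_s)` (variables are natural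
numbers). -/
structure Rule (σ : Schema) : Type where
  head : σ.Rel
  hargs : Fin (σ.arity head) → ℕ
  body : List (PAtom σ ℕ)

/-- A datalogΟ program: a finite set (list) of rules. -/
structure Program (σ : Schema) : Type where
  rules : List (Rule σ)

namespace Program
variable {σ : Schema}

/-- The IDB relations: those occurring in rule heads. -/
def IDB (π : Program σ) : Set σ.Rel := {R | ∃ r ∈ π.rules, r.head = R}

/-- Every head variable occurs in the corresponding body. -/
def Safe (π : Program σ) : Prop :=
  ∀ r ∈ π.rules, ∀ i, ∃ p ∈ r.body, ∃ j, p.args j = r.hargs i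

/-- Every rule body contains at most one IDB atom. -/
def Linear (π : Program σ) : Prop :=
  ∀ r ∈ π.rules, (∀ p ∈ r.body, p.R ∉ π.IDB) ∨
    ∃ L₁ a L₂, r.body = L₁ ++ a :: L₂ ∧ a.R ∈ π.IDB ∧
      (∀ p ∈ L₁, p.R ∉ π.IDB) ∧ (∀ p ∈ L₂, p.R ∉ π.IDB)

/-- Every IDB relation is unary. -/
def Monadic (π : Program σ) : Prop := ∀ R ∈ π.IDB, σ.arity R = 1

/-- Only the operators ○ and ○⁻ occur in the program. -/
def NextOnly (π : Program σ) : Prop :=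
  ∀ r ∈ π.rules, ∀ p ∈ r.body, ∀ o ∈ p.ops, o = TOp.onext ∨ o = TOp.oprev

/-- `K_π`: the maximal number of nested temporal operators in a rule body. -/
def depth (π : Program σ) : ℕ :=
  (π.rules.map (fun r => (r.body.map (fun p => p.ops.length)).foldr max 0)).foldr max 0

end Program

def PAtom.size {σ : Schema} (p : PAtom σ ℕ) : ℕ := 1 + p.ops.length + σ.arity p.R

def Rule.size {σ : Schema} (r : Rule σ) : ℕ :=
  1 + σ.arity r.head + (r.body.map PAtom.size).sum

/-- The size `|π|` of a program. -/
def Program.size {σ : Schema} (π : Program σ) : ℕ := (π.rules.map Rule.size).sum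

/-- The Gaifman graph of the body is connected. -/
def BodyConnected {σ : Schema} (L : List (PAtom σ ℕ)) : Prop :=
  ∀ u v : ℕ, (∃ p ∈ L, ∃ i, p.args i = u) → (∃ p ∈ L, ∃ i, p.args i = v) →
    Relation.ReflTransGen (fun x y => ∃ p ∈ L, (∃ i, p.args i = x) ∧ ∃ j, p.args j = y) u v

def Program.Connected {σ : Schema} (π : Program σ) : Prop :=
  ∀ r ∈ π.rules, BodyConnected r.body

/-- The temporal database only mentions EDB relations of `π`. -/
def OverEDB {σ : Schema} {Obj : Type} (π : Program σ) (D : TemporalDB σ Obj) : Prop :=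
  ∀ t : ℤ, ∀ a ∈ D.slice t, a.1 ∉ π.IDB

/-! ### Enrichments, models and certain answers.
These are formulated for an abstract database given by a set `Δ` of objects
together with a ℤ-indexed family `I` of sets of (EDB) atoms. -/

/-- `E` is an enrichment of the database `(Δ, I)`: its EDB atoms are exactly
those of `I` and all its objects come from `Δ`. -/
def IsEnrichment {σ : Schema} {Obj : Type} (π : Program σ) (Δ : Set Obj)
    (I : ℤ → Set (Atom σ Obj)) (E : ℤ → Set (Atom σ Obj)) : Prop :=
  (∀ t : ℤ, ∀ a ∈ I t, a ∈ E t) ∧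
  (∀ t : ℤ, ∀ a ∈ E t, a.1 ∉ π.IDB → a ∈ I t) ∧
  (∀ t : ℤ, ∀ a ∈ E t, ∀ i, a.2 i ∈ Δ)

/-- `E` satisfies the rule `r` at every time point, for all assignments of the
variables into `Δ`. -/
def SatRule {σ : Schema} {Obj : Type} (Δ : Set Obj) (E : ℤ → Set (Atom σ Obj))
    (r : Rule σ) : Prop :=
  ∀ ν : ℕ → Obj, (∀ v, ν v ∈ Δ) → ∀ ℓ : ℤ,
    (∀ p ∈ r.body, PAtom.sat E ν ℓ p) →
    (⟨r.head, fun i => ν (r.hargs i)⟩ : Atom σ Obj) ∈ E ℓ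

/-- `E` is a model of `π` and the database `(Δ, I)`. -/
def IsModel {σ : Schema} {Obj : Type} (π : Program σ) (Δ : Set Obj)
    (I : ℤ → Set (Atom σ Obj)) (E : ℤ → Set (Atom σ Obj)) : Prop :=
  IsEnrichment π Δ I E ∧ ∀ r ∈ π.rules, SatRule Δ E r

/-- Certain answers: `a` holds at time `ℓ` in every model of `π` and `(Δ, I)`;
this is the relation `𝒟, π, ℓ ⊨ a`. -/
def Certain {σ : Schema} {Obj : Type} (π : Program σ) (Δ : Set Obj)
    (I : ℤ → Set (Atom σ Obj)) (ℓ : ℤ) (a : Atom σ Obj) : Prop :=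
  ∀ E : ℤ → Set (Atom σ Obj), IsModel π Δ I E → a ∈ E ℓ

/-! ### Expansions of linear monadic queries -/

/-- Standard renaming making the head variable `x` the answer variable `0` and
moving all other variables injectively away from `0`. -/
def stdRen (x : ℕ) : ℕ → ℕ := fun v => if v = x then 0 else v + 1

def PAtom.maxVar {σ : Schema} (p : PAtom σ ℕ) : ℕ := Finset.univ.sup p.args

def bodyMaxVar {σ : Schema} (L : List (PAtom σ ℕ)) : ℕ :=
  (L.map PAtom.maxVar).foldr max 0

/-- Renaming used for composition: the answer variable `0` of the inner query is
mapped to `y` and all other variables are shifted beyond `N` (fresh). -/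
def compRen (y N : ℕ) : ℕ → ℕ := fun v => if v = 0 then y else v + N

/-- Composition `Q ∘ P`: the unique IDB atom (with prefix `ops` and variable `y`)
of the outer query is replaced by the renamed-apart inner query `w`. -/
def composeW {σ : Schema} (base : List (PAtom σ ℕ)) (ops : List TOp) (y : ℕ)
    (w : List (PAtom σ ℕ)) : List (PAtom σ ℕ) :=
  base ++ w.map (fun p =>
    ⟨ops ++ p.ops, p.R, fun i => compRen y (max (bodyMaxVar base) y) (p.args i)⟩)

/-- `IsExpansion π C w`: `w` (a unary temporal CQ with answer variable `0`) is an
expansion of the query `(π, C)`. -/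
inductive IsExpansion {σ : Schema} (π : Program σ) : σ.Rel → List (PAtom σ ℕ) → Prop where
  | init (r : Rule σ) (x : ℕ) (hr : r ∈ π.rules) (hx : ∀ i, r.hargs i = x)
      (hinit : ∀ p ∈ r.body, p.R ∉ π.IDB) :
      IsExpansion π r.head (r.body.map (PAtom.map (stdRen x)))
  | step (r : Rule σ) (x : ℕ) (hr : r ∈ π.rules) (hx : ∀ i, r.hargs i = x)
      (L₁ L₂ : List (PAtom σ ℕ)) (a : PAtom σ ℕ) (y : ℕ)
      (hbody : r.body = L₁ ++ a :: L₂) (hIDB : a.R ∈ π.IDB)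
      (hE : ∀ p ∈ L₁ ++ L₂, p.R ∉ π.IDB) (hy : ∀ j, a.args j = y)
      (w : List (PAtom σ ℕ)) (hw : IsExpansion π a.R w) :
      IsExpansion π r.head
        (composeW ((L₁ ++ L₂).map (PAtom.map (stdRen x))) a.ops (stdRen x y) w)

/-- `𝒟, ℓ ⊨ w(d)` for a unary temporal CQ `w` with answer variable `0`. -/
def ExpSat {σ : Schema} {Obj : Type} (D : TemporalDB σ Obj) (ℓ : ℤ)
    (w : List (PAtom σ ℕ)) (d : Obj) : Prop :=
  ∃ ν : ℕ → Obj, (∀ v, ν v ∈ D.Δ) ∧ ν 0 = d ∧ ∀ p ∈ w, PAtom.sat D.slice ν ℓ p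

/-- The set of variables occurring in a temporal CQ given as a list of
temporalised atoms. -/
def bodyVars {σ : Schema} (w : List (PAtom σ ℕ)) : Set ℕ :=
  {v | ∃ p ∈ w, ∃ j, p.args j = v}

/-! ### Entailment sequences for linear programs -/

/-- The prefix `○^k` for `k ∈ {-1, 0, 1}`. -/
def opsOfInt (k : ℤ) : List TOp :=
  if k = 1 then [TOp.onext] else if k = -1 then [TOp.oprev] else []

/-- `C(c̄) ←_{ℓ,k} D(d̄)`: some recursive rule of `π` whose IDB atom carries the
prefix `○^k` witnesses the step at time `ℓ` in the database `D`. -/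
def StepRel {σ : Schema} {Obj : Type} (π : Program σ) (D : TemporalDB σ Obj)
    (ℓ k : ℤ) (ca da : Atom σ Obj) : Prop :=
  ∃ r ∈ π.rules, ∃ L₁ a L₂, r.body = L₁ ++ a :: L₂ ∧ a.R ∈ π.IDB ∧
    (∀ p ∈ L₁ ++ L₂, p.R ∉ π.IDB) ∧ a.ops = opsOfInt k ∧
    ∃ ν : ℕ → Obj, (∀ v, ν v ∈ D.Δ) ∧
      ca = ⟨r.head, fun i => ν (r.hargs i)⟩ ∧ da = ⟨a.R, fun i => ν (a.args i)⟩ ∧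
      ∀ p ∈ L₁ ++ L₂, PAtom.sat D.slice ν ℓ p

/-- `C(c̄) ←_ℓ`: some initialisation rule of `π` witnesses `C(c̄)` at time `ℓ`. -/
def InitRel {σ : Schema} {Obj : Type} (π : Program σ) (D : TemporalDB σ Obj)
    (ℓ : ℤ) (ca : Atom σ Obj) : Prop :=
  ∃ r ∈ π.rules, (∀ p ∈ r.body, p.R ∉ π.IDB) ∧
    ∃ ν : ℕ → Obj, (∀ v, ν v ∈ D.Δ) ∧ ca = ⟨r.head, fun i => ν (r.hargs i)⟩ ∧
      ∀ p ∈ r.body, PAtom.sat D.slice ν ℓ p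

/-- An entailment sequence `C₀(c̄₀) ←_{ℓ₀,k₀} C₁(c̄₁) ←_{ℓ₁,k₁} … ←_{ℓ_{n−1},k_{n−1}} C_n(c̄_n)`. -/
def IsEntSeq {σ : Schema} {Obj : Type} (π : Program σ) (D : TemporalDB σ Obj)
    (n : ℕ) (A : Fin (n+1) → Atom σ Obj) (ℓs : Fin (n+1) → ℤ) (ks : Fin n → ℤ) : Prop :=
  ∀ i : Fin n, ks i ∈ ({-1, 0, 1} : Set ℤ) ∧
    StepRel π D (ℓs i.castSucc) (ks i) (A i.castSucc) (A i.succ) ∧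
    ℓs i.succ = ℓs i.castSucc + ks i

/-- An initialized entailment sequence. -/
def IsInitEntSeq {σ : Schema} {Obj : Type} (π : Program σ) (D : TemporalDB σ Obj)
    (n : ℕ) (A : Fin (n+1) → Atom σ Obj) (ℓs : Fin (n+1) → ℤ) (ks : Fin n → ℤ) : Prop :=
  IsEntSeq π D n A ℓs ks ∧ InitRel π D (ℓs (Fin.last n)) (A (Fin.last n))

/-- Every IDB atom occurring in a rule body carries a prefix `○^k` with `k ∈ {-1,0,1}`. -/
def SmallIDBPrefix {σ : Schema} (π : Program σ) : Prop :=
  ∀ r ∈ π.rules, ∀ p ∈ r.body, p.R ∈ π.IDB →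
    p.ops = [] ∨ p.ops = [TOp.onext] ∨ p.ops = [TOp.oprev]

/-! ### Cut models -/

/-- `r(d)`: the maximal timestamp at which `D` contains an atom involving `d`. -/
noncomputable def maxT {σ : Schema} {Obj : Type} (D : TemporalDB σ Obj) (d : Obj) : ℤ :=
  sSup {t : ℤ | ∃ a ∈ D.slice t, ∃ i, a.2 i = d}

/-- `−l(d)`: the minimal timestamp at which `D` contains an atom involving `d`. -/
noncomputable def minT {σ : Schema} {Obj : Type} (D : TemporalDB σ Obj) (d : Obj) : ℤ :=
  sInf {t : ℤ | ∃ a ∈ D.slice t, ∃ i, a.2 i = d}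

/-- `F` is an `n`-cut model of `D` and `π`: obtained from a model by discarding,
for every object `d`, all atoms involving `d` with timestamp outside
`[−l(d)−n, r(d)+n]`. -/
def IsCutModel {σ : Schema} {Obj : Type} (π : Program σ) (D : TemporalDB σ Obj)
    (n : ℕ) (F : ℤ → Set (Atom σ Obj)) : Prop :=
  ∃ E : ℤ → Set (Atom σ Obj), IsModel π D.Δ D.slice E ∧
    ∀ t : ℤ, F t = {a | a ∈ E t ∧ ∀ d : Obj, (∃ i, a.2 i = d) →
      minT D d - n ≤ t ∧ t ≤ maxT D d + n}
/-! ## 2-counter (Minsky) machines and the program `π_M` -/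

/-- A 2-counter machine with states `s₀, …, s_n` (`s₀` initial) and partial
transition function `Θ`; `Bool` encodes the signs (`true` = `+`, `false` = `0`)
and `Fin 3` encodes the counter updates `−1, 0, 1` (via `val3`). -/
structure CM : Type where
  n : ℕ
  Θ : Fin (n+1) → Bool → Bool → Option (Fin (n+1) × Fin 3 × Fin 3)

def val3 (e : Fin 3) : ℤ := (e : ℤ) - 1

def CM.step (M : CM) (c : Fin (M.n+1) × ℤ × ℤ) : Option (Fin (M.n+1) × ℤ × ℤ) :=
  (M.Θ c.1 (decide (0 < c.2.1)) (decide (0 < c.2.2))).map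
    (fun x => (x.1, c.2.1 + val3 x.2.1, c.2.2 + val3 x.2.2))

/-- The computation of `M` (configuration after `k` steps, if defined). -/
def CM.run (M : CM) : ℕ → Option (Fin (M.n+1) × ℤ × ℤ)
  | 0 => some (0, 0, 0)
  | k+1 => (M.run k).bind M.step

/-- The counters stay nonnegative along the computation. -/
def CM.Valid (M : CM) : Prop :=
  ∀ (k : ℕ) (s : Fin (M.n+1)) (a b : ℤ), M.run k = some (s, a, b) → 0 ≤ a ∧ 0 ≤ b

/-- The relations of the schema of `π_M`: EDB relations `T, U₁, U₂` (binary) and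
IDB relations `G`, `RV`, `NE_c^ε`, `S_i` (unary); `m` is the number of states. -/
inductive MRel (m : ℕ) : Type where
  | T | U1 | U2 | G | RV
  | NE (c : Bool) (e : Fin 3)
  | S (i : Fin m)
deriving DecidableEq

def MSchema (m : ℕ) : Schema :=
  ⟨MRel m, fun r => match r with
    | .T => 2
    | .U1 => 2
    | .U2 => 2
    | _ => 1⟩

def paT {m : ℕ} (ops : List TOp) (x y : ℕ) : PAtom (MSchema m) ℕ := ⟨ops, MRel.T, ![x, y]⟩

/-- `U_c`-atom (`c = true` is `U₁`, `c = false` is `U₂`). -/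
def paU {m : ℕ} : Bool → List TOp → ℕ → ℕ → PAtom (MSchema m) ℕ
  | true, ops, x, y => ⟨ops, MRel.U1, ![x, y]⟩
  | false, ops, x, y => ⟨ops, MRel.U2, ![x, y]⟩

def paRV {m : ℕ} (ops : List TOp) (x : ℕ) : PAtom (MSchema m) ℕ := ⟨ops, MRel.RV, ![x]⟩

def paNE {m : ℕ} (c : Bool) (e : Fin 3) (ops : List TOp) (x : ℕ) : PAtom (MSchema m) ℕ :=
  ⟨ops, MRel.NE c e, ![x]⟩

def paS {m : ℕ} (i : Fin m) (ops : List TOp) (x : ℕ) : PAtom (MSchema m) ℕ :=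
  ⟨ops, MRel.S i, ![x]⟩

/-- A rule with (unary) head `h(X)` where `X` is the variable `0`. -/
def mkR {m : ℕ} (h : MRel m) (body : List (PAtom (MSchema m) ℕ)) : Rule (MSchema m) :=
  ⟨h, fun _ => 0, body⟩

def dia : List TOp := [TOp.diaF]

/-- `◇^α` for a sign `α`. -/
def dOf (b : Bool) : List TOp := if b then [TOp.diaF] else []

/-- The two prefixes realising `◇*` (`◇*φ ≡ ◇φ ∨ φ`). -/
def starPre : List (List TOp) := [[], [TOp.diaF]]

/-- Representation-violation rules (variables: `X = 0`, `Y = 1`, `Z = 2`). -/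
def rvRules (m : ℕ) : List (Rule (MSchema m)) :=
  [ mkR .RV [paT [] 0 1, paT dia 0 2],
    mkR .RV [paU true [] 0 1, paU true dia 0 2],
    mkR .RV [paU false [] 0 1, paU false dia 0 2] ]

/-- Transition-violation detection rules for counter `c`
(variables: `Y = 0`, `X = 1`, `Z = 2`; `e : Fin 3` encodes `ε = e − 1`). -/
def neRules (m : ℕ) (c : Bool) : List (Rule (MSchema m)) :=
  [ mkR (.NE c 0) [paU c [] 0 2, paU c [] 1 0],
    mkR (.NE c 0) [paU c [] 0 2, paU c [TOp.diaF, TOp.diaF] 1 0],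
    mkR (.NE c 0) [paU c [] 1 0, paU c dia 0 2],
    mkR (.NE c 2) [paU c [] 0 2, paU c [] 1 0],
    mkR (.NE c 2) [paU c [] 0 2, paU c dia 1 0],
    mkR (.NE c 2) [paU c [] 1 0, paU c [TOp.diaF, TOp.diaF] 0 2],
    mkR (.NE c 1) [paU c [] 0 2, paU c dia 1 0],
    mkR (.NE c 1) [paU c [] 1 0, paU c dia 0 2] ]

/-- The rules `S_i(X) ← ◇* RV(X)`. -/
def sRvRules (m : ℕ) : List (Rule (MSchema m)) :=
  (List.finRange m).flatMap fun i =>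
    [ mkR (.S i) [paRV [] 0], mkR (.S i) [paRV dia 0] ]

/-- The rules `S_i(X) ← ◇* NE_c^ε(Y) ∧ ◇^α U_c(X,Y)` (variables `X = 0`, `Y = 1`). -/
def neViol (m : ℕ) (c : Bool) (e : Fin 3) (α : Bool) (i : Fin m) : List (Rule (MSchema m)) :=
  starPre.map fun pre => mkR (.S i) [paNE c e pre 1, paU c (dOf α) 0 1]

/-- The transition rules of `π_M`. -/
def transRules (M : CM) : List (Rule (MSchema (M.n+1))) :=
  (List.finRange (M.n+1)).flatMap fun i =>
    [false, true].flatMap fun α =>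
      [false, true].flatMap fun β =>
        match M.Θ i α β with
        | some (j, e1, e2) =>
            neViol (M.n+1) true e1 α i ++ neViol (M.n+1) false e2 β i ++
            [ mkR (.S i) [paT [] 0 1, paU true (dOf α) 0 1, paU false (dOf β) 0 1,
                paS j [] 1] ]
        | none =>
            ((List.finRange 3).flatMap fun e1 => neViol (M.n+1) true e1 α i) ++
            ((List.finRange 3).flatMap fun e2 => neViol (M.n+1) false e2 β i)

/-- The program `π_M` associated with the 2-counter machine `M`. -/
def piM (M : CM) : Program (MSchema (M.n+1)) :=
  ⟨ [ mkR .G [paS 0 [] 0, paU true [] 0 1, paU false [] 0 1] ] ++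
    rvRules (M.n+1) ++ sRvRules (M.n+1) ++
    neRules (M.n+1) true ++ neRules (M.n+1) false ++ transRules M ⟩
/-! ## The alphabet Ω and languages of words for ○/○⁻ queries -/

inductive Marker : Type where
  | bot | top
deriving DecidableEq

/-- A letter of the alphabet `Ω = 2^{Γ^r_π ∪ Γ^i_π ∪ {⊥,⊤}}` (rule bodies are
represented by their rules). -/
abbrev Lett (σ : Schema) : Type := Set (Marker ⊕ Rule σ)

/-- `a` is the (unique, for linear rules) IDB atom of the body of `r`. -/
def RecDecomp {σ : Schema} (π : Program σ) (r : Rule σ) (a : PAtom σ ℕ) : Prop :=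
  ∃ L₁ L₂, r.body = L₁ ++ a :: L₂ ∧ a.R ∈ π.IDB ∧
    (∀ p ∈ L₁, p.R ∉ π.IDB) ∧ (∀ p ∈ L₂, p.R ∉ π.IDB)

/-- An initialisation rule: no IDB atom in the body. -/
def IsInitRule {σ : Schema} (π : Program σ) (r : Rule σ) : Prop :=
  ∀ p ∈ r.body, p.R ∉ π.IDB

/-- A horizontal recursive rule: the IDB atom uses the head variable. -/
def IsHorizontalR {σ : Schema} (π : Program σ) (r : Rule σ) : Prop :=
  ∃ a, RecDecomp π r a ∧ ∀ j i, a.args j = r.hargs i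

/-- A vertical recursive rule: the IDB atom uses a variable different from the
head variable. -/
def IsVerticalR {σ : Schema} (π : Program σ) (r : Rule σ) : Prop :=
  ∃ a, RecDecomp π r a ∧ ∃ j i, a.args j ≠ r.hargs i

/-- A vertical letter: a singleton containing a vertical rule body. -/
def IsVertLett {σ : Schema} (π : Program σ) (Λ : Lett σ) : Prop :=
  ∃ r ∈ π.rules, IsVerticalR π r ∧ Λ = {Sum.inr r}

/-- A horizontal letter: a set of horizontal (or initialisation) rule bodies,
possibly containing the markers ⊥, ⊤. -/
def IsHorLett {σ : Schema} (π : Program σ) (Λ : Lett σ) : Prop :=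
  ∀ x ∈ Λ, x = Sum.inl Marker.bot ∨ x = Sum.inl Marker.top ∨
    ∃ r ∈ π.rules, x = Sum.inr r ∧ (IsHorizontalR π r ∨ IsInitRule π r)

def TOp.shift : TOp → ℤ
  | .onext => 1
  | .oprev => -1
  | .diaF => 0
  | .diaP => 0

/-- The net time shift of a prefix of ○/○⁻ operators. -/
def netShift (ops : List TOp) : ℤ := (ops.map TOp.shift).sum

/-- The time shift `m` of the IDB atom `○^m C(Y)` of a recursive rule. -/
noncomputable def idbShift {σ : Schema} (π : Program σ) (r : Rule σ) : ℤ :=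
  if h : ∃ a, RecDecomp π r a then netShift h.choose.ops else 0

/-- A decomposition of a word over `Ω` into alternating vertical segments
(given by their lists of vertical rules together with their IDB atoms) and
horizontal segments, together with the positions of ⊥ and ⊤ in each horizontal
segment. -/
structure SegData (σ : Schema) : Type where
  n : ℕ
  xs : Fin n → List (Rule σ)
  axs : (i : Fin n) → Fin (xs i).length → PAtom σ ℕ
  ys : Fin n → List (Lett σ)
  botIdx : Fin n → ℕ
  topIdx : Fin n → ℕ

/-- The word over `Ω` determined by a decomposition. -/
def SegData.word {σ : Schema} (d : SegData σ) : List (Lett σ) :=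
  (List.ofFn fun i => ((d.xs i).map fun r => ({Sum.inr r} : Lett σ)) ++ d.ys i).flatten

/-- `x` occurs in exactly one letter of `y`, namely in the one at position `k`. -/
def ExactlyOneAt {σ : Schema} (x : Marker ⊕ Rule σ) (y : List (Lett σ)) (k : ℕ) : Prop :=
  ∃ h : k < y.length, x ∈ y.get ⟨k, h⟩ ∧
    ∀ k' (h' : k' < y.length), x ∈ y.get ⟨k', h'⟩ → k' = k

/-- The decomposition is a correct one for `π`:  vertical segments consist of
vertical rules, horizontal segments of horizontal letters, inner segments are
nonempty (maximality), every horizontal segment preceded by a vertical segment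
contains exactly one ⊥ (at `botIdx`), every horizontal segment followed by a
vertical segment contains exactly one ⊤ (at `topIdx`); for a leading horizontal
segment, `botIdx` is the time-0 anchor. -/
structure GoodSeg {σ : Schema} (π : Program σ) (d : SegData σ) : Prop where
  mem : ∀ (i : Fin d.n) (p : Fin (d.xs i).length), (d.xs i).get p ∈ π.rules
  recd : ∀ (i : Fin d.n) (p : Fin (d.xs i).length), RecDecomp π ((d.xs i).get p) (d.axs i p)
  vert : ∀ (i : Fin d.n) (p : Fin (d.xs i).length),
    ∃ j i', (d.axs i p).args j ≠ ((d.xs i).get p).hargs i'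
  hor : ∀ i : Fin d.n, ∀ Λ ∈ d.ys i, IsHorLett π Λ
  xs_ne : ∀ i : Fin d.n, (i : ℕ) ≠ 0 → d.xs i ≠ []
  ys_ne : ∀ i : Fin d.n, (i : ℕ) ≠ d.n - 1 → d.ys i ≠ []
  bot_one : ∀ i : Fin d.n, d.xs i ≠ [] → d.ys i ≠ [] →
    ExactlyOneAt (Sum.inl Marker.bot) (d.ys i) (d.botIdx i)
  bot_anchor : ∀ i : Fin d.n, d.xs i = [] →
    ((∃ k, ∃ h : k < (d.ys i).length, Sum.inl Marker.bot ∈ (d.ys i).get ⟨k, h⟩) →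
      ∃ h : d.botIdx i < (d.ys i).length,
        Sum.inl Marker.bot ∈ (d.ys i).get ⟨d.botIdx i, h⟩)
  bot_anchor' : ∀ i : Fin d.n, d.xs i = [] →
    (¬ (∃ k, ∃ h : k < (d.ys i).length, Sum.inl Marker.bot ∈ (d.ys i).get ⟨k, h⟩)) →
      d.botIdx i = 0
  top_one : ∀ i : Fin d.n, (i : ℕ) < d.n - 1 →
    ExactlyOneAt (Sum.inl Marker.top) (d.ys i) (d.topIdx i)

/-- A correct word over `Ω`. -/
def Correct {σ : Schema} (π : Program σ) (α : List (Lett σ)) : Prop :=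
  ∃ d : SegData σ, GoodSeg π d ∧ d.word = α

/-! ### The temporal database `𝒟_α` of a correct word -/

/-- Time offset, within the vertical part of segment `i`, of the `p`-th vertical
rule (sum of the IDB-prefix shifts of the earlier rules of the segment). -/
noncomputable def vtimeOff {σ : Schema} (d : SegData σ) (i : Fin d.n) (p : ℕ) : ℤ :=
  ∑ q : Fin (d.xs i).length, if (q : ℕ) < p then netShift (d.axs i q).ops else 0

/-- The entry time of segment `i` (time at which the first body of the segment
lands). -/
noncomputable def segEntry {σ : Schema} (d : SegData σ) : ℕ → ℤ
  | 0 => 0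
  | i+1 =>
    if h : i < d.n then
      segEntry d i + vtimeOff d ⟨i, h⟩ (d.xs ⟨i, h⟩).length +
        ((d.topIdx ⟨i, h⟩ : ℤ) - (d.botIdx ⟨i, h⟩ : ℤ))
    else segEntry d i

/-- The landing time of the `p`-th vertical rule of segment `i`. -/
noncomputable def vtime {σ : Schema} (d : SegData σ) (i : Fin d.n) (p : ℕ) : ℤ :=
  segEntry d i + vtimeOff d i p

/-- The time of the `j`-th letter of the horizontal part of segment `i`
(the letter at `botIdx` sits at the exit time of the vertical part). -/
noncomputable def htime {σ : Schema} (d : SegData σ) (i : Fin d.n) (j : ℕ) : ℤ :=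
  segEntry d i + vtimeOff d i (d.xs i).length + ((j : ℤ) - (d.botIdx i : ℤ))

/-- The number of vertical rules in the segments before segment `i` (used for
the indices of the spine variables). -/
def sOf {σ : Schema} (d : SegData σ) (i : ℕ) : ℕ :=
  ∑ j ∈ Finset.range i, if h : j < d.n then (d.xs ⟨j, h⟩).length else 0

/-- The objects of `𝒟_α`: spine variables (`Sum.inl`) and renamed-apart copies
of the remaining variables of each body occurrence (`Sum.inr`). -/
def WObj (σ : Schema) : Type := ℕ ⊕ (ℕ × ℕ × Rule σ × ℕ)

/-- Renaming of the variables of the `p`-th vertical rule of segment `i`: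
head variable ↦ its spine variable, IDB variable ↦ the next spine variable,
other variables ↦ fresh copies. -/
noncomputable def vRen {σ : Schema} (d : SegData σ) (i : Fin d.n)
    (p : Fin (d.xs i).length) (v : ℕ) : WObj σ :=
  if ∃ ii, ((d.xs i).get p).hargs ii = v then Sum.inl (sOf d i + p)
  else if ∃ jj, (d.axs i p).args jj = v then Sum.inl (sOf d i + p + 1)
  else Sum.inr (i, p, (d.xs i).get p, v)

/-- Renaming of the variables of a body `r` occurring in the `j`-th letter of
the horizontal part of segment `i`: head variable ↦ the spine variable shared by
the whole horizontal segment, other variables ↦ fresh copies. -/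
noncomputable def hRen {σ : Schema} (d : SegData σ) (i : Fin d.n) (j : ℕ)
    (r : Rule σ) (v : ℕ) : WObj σ :=
  if ∃ ii, r.hargs ii = v then Sum.inl (sOf d i + (d.xs i).length)
  else Sum.inr (i, (d.xs i).length + j, r, v)

/-- The slices of the temporal database `𝒟_α` determined by a decomposition:
the (EDB atoms of the) bodies of the word, placed at their time offsets, with
variables renamed apart along the composition. -/
noncomputable def segSlice {σ : Schema} (π : Program σ) (d : SegData σ) (t : ℤ) :
    Set (Atom σ (WObj σ)) :=
  {a | (∃ i : Fin d.n, ∃ p : Fin (d.xs i).length, ∃ q ∈ ((d.xs i).get p).body,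
          q.R ∉ π.IDB ∧ t = vtime d i p + netShift q.ops ∧
          a = ⟨q.R, fun z => vRen d i p (q.args z)⟩) ∨
       (∃ i : Fin d.n, ∃ j : Fin (d.ys i).length, ∃ r : Rule σ,
          Sum.inr r ∈ (d.ys i).get j ∧ ∃ q ∈ r.body, q.R ∉ π.IDB ∧
          t = htime d i j + netShift q.ops ∧
          a = ⟨q.R, fun z => hRen d i j r (q.args z)⟩)}

/-- The objects occurring in `𝒟_α`. -/
noncomputable def segΔ {σ : Schema} (π : Program σ) (d : SegData σ) : Set (WObj σ) :=
  {o | ∃ t : ℤ, ∃ a ∈ segSlice π d t, ∃ i, a.2 i = o}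

/-- `Accept(π, G)`: the correct words `α` with `𝒟_α, π, 0 ⊨ G(X)`, where `X` is
the answer variable (the first spine variable) of `Q_α`. -/
noncomputable def Accept {σ : Schema} (π : Program σ) (G : σ.Rel)
    (α : List (Lett σ)) : Prop :=
  ∃ d : SegData σ, GoodSeg π d ∧ d.word = α ∧
    Certain π (segΔ π d) (segSlice π d) 0 ⟨G, fun _ => Sum.inl 0⟩

/-- The height of a word: its number of vertical letters. -/
noncomputable def height {σ : Schema} (π : Program σ) (α : List (Lett σ)) : ℕ :=
  Set.ncard {k : Fin α.length | IsVertLett π (α.get k)}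

/-- `(π, G)` is vertically unbounded. -/
noncomputable def VUnbounded {σ : Schema} (π : Program σ) (G : σ.Rel) : Prop :=
  ∀ k : ℕ, ∃ α : List (Lett σ), Accept π G α ∧ height π α > k ∧
    ∀ β, β <+: α → height π β = k → ¬ Accept π G β

/-- The relation `α ≼ β`: same vertical segments, and each horizontal segment of
`α` embeds letterwise (as sets, after a shift) into the corresponding horizontal
segment of `β`. -/
def PrecEq {σ : Schema} (π : Program σ) (α β : List (Lett σ)) : Prop :=
  ∃ (n : ℕ) (xs : Fin n → List (Rule σ)) (ys ys' : Fin n → List (Lett σ)),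
    (∀ i, ∀ r ∈ xs i, r ∈ π.rules ∧ IsVerticalR π r) ∧
    (∀ i, ∀ Λ ∈ ys i, IsHorLett π Λ) ∧
    (∀ i, ∀ Λ ∈ ys' i, IsHorLett π Λ) ∧
    α = (List.ofFn fun i => ((xs i).map fun r => ({Sum.inr r} : Lett σ)) ++ ys i).flatten ∧
    β = (List.ofFn fun i => ((xs i).map fun r => ({Sum.inr r} : Lett σ)) ++ ys' i).flatten ∧
    ∀ i, ∃ k, ∃ hk : (ys i).length + k ≤ (ys' i).length,
      ∀ j (hj : j < (ys i).length),
        (ys i).get ⟨j, hj⟩ ⊆ (ys' i).get ⟨j + k, by omega⟩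
/-! ### Expansions as words of rule bodies, and their descriptions -/

/-- `IsExpSeq π C w`: the sequence of rules `w` is an expansion of `(π, C)`,
i.e. a word in `(Γ^r_π)* Γ^i_π` following the rules of `π` from head `C`. -/
inductive IsExpSeq {σ : Schema} (π : Program σ) : σ.Rel → List (Rule σ) → Prop where
  | init (r : Rule σ) (hr : r ∈ π.rules) (hi : IsInitRule π r) : IsExpSeq π r.head [r]
  | step (r : Rule σ) (a : PAtom σ ℕ) (hr : r ∈ π.rules) (ha : RecDecomp π r a)
      (w : List (Rule σ)) (hw : IsExpSeq π a.R w) : IsExpSeq π r.head (r :: w)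

/-- Landing time `ℓ_{j+1} = Σ_{i ≤ j} m_i` of the `j`-th body of a horizontal
run (`landing h h.length` is the exit time of the run). -/
noncomputable def landing {σ : Schema} (π : Program σ) (h : List (Rule σ)) (j : ℕ) : ℤ :=
  ∑ i ∈ Finset.range j, ((h[i]?).map (idbShift π)).getD 0

noncomputable def landSet {σ : Schema} (π : Program σ) (h : List (Rule σ)) : Finset ℤ :=
  (Finset.range (h.length + 1)).image (landing π h)

noncomputable def landLo {σ : Schema} (π : Program σ) (h : List (Rule σ)) : ℤ :=
  (landSet π h).min' ((Finset.nonempty_range_iff.mpr (Nat.succ_ne_zero _)).image _)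

noncomputable def landHi {σ : Schema} (π : Program σ) (h : List (Rule σ)) : ℤ :=
  (landSet π h).max' ((Finset.nonempty_range_iff.mpr (Nat.succ_ne_zero _)).image _)

/-- The letter of the description of a horizontal run `h` at time point `t`:
the set of bodies of the run landing at `t`, with ⊥ at the landing point of the
first body and (when the run is followed by a vertical segment) ⊤ at the exit
point. -/
def hLetter {σ : Schema} (π : Program σ) (h : List (Rule σ)) (withTop : Bool)
    (t : ℤ) : Lett σ :=
  {x | (∃ j : ℕ, ∃ r, h[j]? = some r ∧ landing π h j = t ∧ x = Sum.inr r) ∨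
       (t = 0 ∧ x = Sum.inl Marker.bot) ∨
       (withTop = true ∧ t = landing π h h.length ∧ x = Sum.inl Marker.top)}

/-- The description of a (maximal) horizontal run, as a word of letters along
its timeline. -/
noncomputable def layoutH {σ : Schema} (π : Program σ) (h : List (Rule σ))
    (withTop : Bool) : List (Lett σ) :=
  (List.range ((landHi π h - landLo π h).toNat + 1)).map fun k =>
    hLetter π h withTop (landLo π h + (k : ℤ))

theorem length_dropWhile_le' {α : Type*} (p : α → Bool) (l : List α) :
    (l.dropWhile p).length ≤ l.length := by
  induction l with
  | nil => simp
  | cons a l ih =>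
    by_cases h : p a <;> simp [List.dropWhile, h] <;> omega

/-- The description `[w] ∈ Ω*` of a composition `w` of rule bodies: vertical
bodies become singleton letters, maximal horizontal runs are laid out along
their timelines. -/
noncomputable def descr {σ : Schema} (π : Program σ) : List (Rule σ) → List (Lett σ)
  | [] => []
  | r :: rest =>
    if IsVerticalR π r then ({Sum.inr r} : Lett σ) :: descr π rest
    else
      layoutH π (r :: rest.takeWhile fun r' => !decide (IsVerticalR π r'))
        (!(rest.dropWhile fun r' => !decide (IsVerticalR π r')).isEmpty)
        ++ descr π (rest.dropWhile fun r' => !decide (IsVerticalR π r'))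
  termination_by w => w.length
  decreasing_by
    · simp
    · simp only [List.length_cons]
      exact Nat.lt_succ_of_le (length_dropWhile_le' _ _)

/-- `Expand_≼(π, G)`: the correct words `α` such that `[w] ≼ α` for some
expansion `w` of `(π, G)`. -/
noncomputable def ExpandPrec {σ : Schema} (π : Program σ) (G : σ.Rel)
    (α : List (Lett σ)) : Prop :=
  Correct π α ∧ ∃ w : List (Rule σ), IsExpSeq π G w ∧ PrecEq π (descr π w) α

/-- A language is regular iff it is accepted by a finite (deterministic)
automaton. -/
def IsRegularLang {A : Type} (L : Set (List A)) : Prop :=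
  ∃ (Q : Type) (_ : Fintype Q) (M : DFA A Q), ∀ w, w ∈ M.accepts ↔ w ∈ L

/-! ### The language `accept(π, G)` on words of rule bodies -/

/-- Objects of the temporal database `𝒟_w` of a composition word `w`:
spine variables and fresh copies (position, variable). -/
def WV : Type := ℕ ⊕ (ℕ × ℕ)

/-- The spine variable at position `i` of `w`: the number of vertical bodies
strictly before position `i`. -/
noncomputable def wSpine {σ : Schema} (π : Program σ) (w : List (Rule σ)) (i : ℕ) : ℕ :=
  Set.ncard {j : Fin w.length | (j : ℕ) < i ∧ IsVerticalR π (w.get j)}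

/-- The landing time of the body at position `i` of `w`. -/
noncomputable def wTime {σ : Schema} (π : Program σ) (w : List (Rule σ)) (i : ℕ) : ℤ :=
  ∑ j ∈ Finset.range i, ((w[j]?).map (idbShift π)).getD 0

/-- Renaming of the variables of the body at position `i` of `w`: head
variable ↦ current spine variable, IDB variable ↦ next spine variable, other
variables ↦ fresh copies. -/
noncomputable def wRen {σ : Schema} (π : Program σ) (w : List (Rule σ)) (i : ℕ)
    (r : Rule σ) (v : ℕ) : WV :=
  if ∃ ii, r.hargs ii = v then Sum.inl (wSpine π w i)
  else if ∃ a, RecDecomp π r a ∧ ∃ jj, a.args jj = v then Sum.inl (wSpine π w (i + 1))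
  else Sum.inr (i, v)

/-- The slices of `𝒟_w` (IDB atoms are omitted). -/
noncomputable def wSlice {σ : Schema} (π : Program σ) (w : List (Rule σ)) (t : ℤ) :
    Set (Atom σ WV) :=
  {a | ∃ i : Fin w.length, ∃ q ∈ (w.get i).body, q.R ∉ π.IDB ∧
        t = wTime π w i + netShift q.ops ∧
        a = ⟨q.R, fun z => wRen π w i (w.get i) (q.args z)⟩}

noncomputable def wΔ {σ : Schema} (π : Program σ) (w : List (Rule σ)) : Set WV :=
  {o | ∃ t : ℤ, ∃ a ∈ wSlice π w t, ∃ i, a.2 i = o}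

/-- `w ∈ accept(π, G)` : `𝒟_w, π, 0 ⊨ G(X)` (where `X` is the answer variable,
i.e. the first spine variable). -/
noncomputable def wAccept {σ : Schema} (π : Program σ) (G : σ.Rel)
    (w : List (Rule σ)) : Prop :=
  Certain π (wΔ π w) (wSlice π w) 0 ⟨G, fun _ => Sum.inl 0⟩

/-- Unboundedness of a (plain datalog) query `(π, G)` : for every `k` there is
an expansion of length `> k` whose prefix of length `k` is not in
`accept(π, G)`. -/
noncomputable def Unbounded {σ : Schema} (π : Program σ) (G : σ.Rel) : Prop :=
  ∀ k : ℕ, ∃ w : List (Rule σ), IsExpSeq π G w ∧ w.length > k ∧ ¬ wAccept π G (w.take k)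

/-- A plain (atemporal) datalog program: no temporal operators occur. -/
def Program.Plain {σ : Schema} (π : Program σ) : Prop :=
  ∀ r ∈ π.rules, ∀ p ∈ r.body, p.ops = []

/-! ### The plain datalog program `π_d` extracted from an automaton for `Accept(π, G)` -/

/-- The schema of `π_d`: one unary relation `S_q` per automaton state `q`, the
unary goal `G`, and one binary relation per (vertical) letter of `Ω`. -/
def SchemaD (σ : Schema) (Q : Type) : Schema :=
  ⟨Q ⊕ (Unit ⊕ Lett σ), fun r => match r with
    | Sum.inl _ => 1
    | Sum.inr (Sum.inl _) => 1
    | Sum.inr (Sum.inr _) => 2⟩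

/-- The plain datalog program `π_d` associated with a DFA `M` for `Accept(π,G)`:
`G(X) ← S₀(X)`;  `S_i(X) ← Λ(X,Y) ∧ S_j(Y)` for vertical transitions
`δ(s_i,Λ) = s_j`;  `S_i(X) ←` for accepting `s_i`;  and `S_i(X) ← S_j(Y)`
whenever some word of horizontal letters drives `M` from `s_i` to `s_j`. -/
noncomputable def piD {σ : Schema} (π : Program σ) {Q : Type} [Fintype Q]
    (M : DFA (Lett σ) Q) : Program (SchemaD σ Q) :=
  ⟨ [⟨Sum.inr (Sum.inl ()), fun _ => 0, [⟨[], Sum.inl M.start, ![0]⟩]⟩] ++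
    (Finset.univ.toList (α := Q)).flatMap (fun i =>
      π.rules.filterMap (fun r =>
        if IsVerticalR π r then
          some ⟨Sum.inl i, fun _ => 0,
            [⟨[], Sum.inr (Sum.inr ({Sum.inr r} : Lett σ)), ![0, 1]⟩,
             ⟨[], Sum.inl (M.step i ({Sum.inr r} : Lett σ)), ![1]⟩]⟩
        else none)) ++
    (Finset.univ.toList (α := Q)).filterMap (fun i =>
      if i ∈ M.accept then some ⟨Sum.inl i, fun _ => 0, []⟩ else none) ++
    (Finset.univ.toList (α := Q)).flatMap (fun i =>
      (Finset.univ.toList (α := Q)).filterMap (fun j =>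
        if ∃ ws : List (Lett σ), (∀ Λ ∈ ws, IsHorLett π Λ) ∧ M.evalFrom i ws = j then
          some ⟨Sum.inl i, fun _ => 0, [⟨[], Sum.inl j, ![1]⟩]⟩
        else none)) ⟩

/-! Statement 18: the concrete (disconnected) program with rules
`G(X) ← A(X) ∧ ○D(X)`, `D(X) ← ○D(X)`, `D(X) ← R(X,Y) ∧ ○⁻B(Y) ∧ ○⁻D(Y)`,
`D(X) ← A(Y) ∧ B(X)`. -/

inductive R18 : Type where
  | G | D | A | B | R
deriving DecidableEq

def S18 : Schema := ⟨R18, fun r => match r with | .R => 2 | _ => 1⟩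

/-- `B₁ = A(X) ∧ ○D(X)`. -/
def r18₁ : Rule S18 := ⟨R18.G, fun _ => 0, [⟨[], R18.A, ![0]⟩, ⟨[TOp.onext], R18.D, ![0]⟩]⟩
/-- `B₂ = ○D(X)`. -/
def r18₂ : Rule S18 := ⟨R18.D, fun _ => 0, [⟨[TOp.onext], R18.D, ![0]⟩]⟩
/-- `B₃ = R(X,Y) ∧ ○⁻B(Y) ∧ ○⁻D(Y)`. -/
def r18₃ : Rule S18 :=
  ⟨R18.D, fun _ => 0,
    [⟨[], R18.R, ![0, 1]⟩, ⟨[TOp.oprev], R18.B, ![1]⟩, ⟨[TOp.oprev], R18.D, ![1]⟩]⟩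
/-- The initialisation rule `D(X) ← A(Y) ∧ B(X)`. -/
def r18₄ : Rule S18 := ⟨R18.D, fun _ => 0, [⟨[], R18.A, ![1]⟩, ⟨[], R18.B, ![0]⟩]⟩

def π18 : Program S18 := ⟨[r18₁, r18₂, r18₃, r18₄]⟩

namespace Statement18

theorem mem_IDB_iff (P : R18) : (P : S18.Rel) ∈ π18.IDB ↔ P = R18.G ∨ P = R18.D := by
  constructor
  · rintro ⟨r, hr, rfl⟩
    simp only [π18, List.mem_cons, List.not_mem_nil, or_false] at hr
    rcases hr with rfl | rfl | rfl | rfl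
    · exact Or.inl rfl
    all_goals exact Or.inr rfl
  · rintro (rfl | rfl)
    · exact ⟨r18₁, by simp [π18], rfl⟩
    · exact ⟨r18₂, by simp [π18], rfl⟩

theorem D_mem_IDB : (R18.D : S18.Rel) ∈ π18.IDB := (mem_IDB_iff _).2 (Or.inr rfl)

theorem A_notMem_IDB : (R18.A : S18.Rel) ∉ π18.IDB := by
  rw [mem_IDB_iff]; rintro (h | h) <;> cases h

theorem B_notMem_IDB : (R18.B : S18.Rel) ∉ π18.IDB := by
  rw [mem_IDB_iff]; rintro (h | h) <;> cases h

theorem R_notMem_IDB : (R18.R : S18.Rel) ∉ π18.IDB := by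
  rw [mem_IDB_iff]; rintro (h | h) <;> cases h

theorem mem_body_of_recDecomp {r : Rule S18} {a : PAtom S18 ℕ} (h : RecDecomp π18 r a) :
    a ∈ r.body := by
  obtain ⟨L₁, L₂, h, -⟩ := h
  simp [h]

theorem recDecomp_r18₁_iff (a : PAtom S18 ℕ) :
    RecDecomp π18 r18₁ a ↔ a = ⟨[TOp.onext], R18.D, ![0]⟩ := by
  constructor
  · intro h
    have hm := mem_body_of_recDecomp h
    obtain ⟨-, -, -, hI, -⟩ := h
    simp only [r18₁, List.mem_cons, List.not_mem_nil, or_false] at hm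
    rcases hm with rfl | rfl
    · exact absurd hI A_notMem_IDB
    · rfl
  · rintro rfl
    refine ⟨[⟨[], R18.A, ![0]⟩], [], rfl, D_mem_IDB, ?_, by simp⟩
    simp only [List.mem_singleton, forall_eq]
    exact A_notMem_IDB

theorem recDecomp_r18₂_iff (a : PAtom S18 ℕ) :
    RecDecomp π18 r18₂ a ↔ a = ⟨[TOp.onext], R18.D, ![0]⟩ := by
  constructor
  · intro h
    simpa [r18₂] using mem_body_of_recDecomp h
  · rintro rfl
    exact ⟨[], [], rfl, D_mem_IDB, by simp, by simp⟩

theorem recDecomp_r18₃_iff (a : PAtom S18 ℕ) :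
    RecDecomp π18 r18₃ a ↔ a = ⟨[TOp.oprev], R18.D, ![1]⟩ := by
  constructor
  · intro h
    have hm := mem_body_of_recDecomp h
    obtain ⟨-, -, -, hI, -⟩ := h
    simp only [r18₃, List.mem_cons, List.not_mem_nil, or_false] at hm
    rcases hm with rfl | rfl | rfl
    · exact absurd hI R_notMem_IDB
    · exact absurd hI B_notMem_IDB
    · rfl
  · rintro rfl
    refine ⟨[⟨[], R18.R, ![0, 1]⟩, ⟨[TOp.oprev], R18.B, ![1]⟩], [], rfl, D_mem_IDB, ?_, by simp⟩
    simpa using ⟨R_notMem_IDB, B_notMem_IDB⟩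

theorem idbShift_eq {σ : Schema} {π : Program σ} {r : Rule σ} {b : PAtom σ ℕ}
    (h : ∀ a, RecDecomp π r a ↔ a = b) : idbShift π r = netShift b.ops := by
  have hex : ∃ a, RecDecomp π r a := ⟨b, (h b).2 rfl⟩
  rw [idbShift, dif_pos hex, (h _).1 hex.choose_spec]

theorem idbShift_r18₁ : idbShift π18 r18₁ = 1 := by
  rw [idbShift_eq recDecomp_r18₁_iff]; rfl

theorem idbShift_r18₂ : idbShift π18 r18₂ = 1 := by
  rw [idbShift_eq recDecomp_r18₂_iff]; rfl

theorem idbShift_r18₃ : idbShift π18 r18₃ = -1 := by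
  rw [idbShift_eq recDecomp_r18₃_iff]; rfl

theorem not_isVerticalR_r18₁ : ¬ IsVerticalR π18 r18₁ := by
  rintro ⟨a, ha, j, i, hne⟩
  rw [recDecomp_r18₁_iff] at ha
  subst ha
  exact hne (congrArg ![0] (Subsingleton.elim (α := Fin 1) j 0))

theorem not_isVerticalR_r18₂ : ¬ IsVerticalR π18 r18₂ := by
  rintro ⟨a, ha, j, i, hne⟩
  rw [recDecomp_r18₂_iff] at ha
  subst ha
  exact hne (congrArg ![0] (Subsingleton.elim (α := Fin 1) j 0))

theorem isVerticalR_r18₃ : IsVerticalR π18 r18₃ :=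
  ⟨_, (recDecomp_r18₃_iff _).2 rfl, (0 : Fin 1), (0 : Fin 1), one_ne_zero (α := ℕ)⟩

/-- The word `B₁B₂ⁿB₃^m`. -/
def word (n m : ℕ) : List (Rule S18) :=
  r18₁ :: (List.replicate n r18₂ ++ List.replicate m r18₃)

variable {n m : ℕ}

theorem length_word : (word n m).length = n + m + 1 := by simp [word]

theorem word_getElem? (i : ℕ) : (word n m)[i]? =
    if i = 0 then some r18₁ else if i ≤ n then some r18₂
    else if i ≤ n + m then some r18₃ else none := by
  rcases i with _ | i
  · simp [word]
  · simp only [word, List.getElem?_cons_succ, List.getElem?_append, List.length_replicate,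
      List.getElem?_replicate]
    grind

theorem word_get (i : Fin (word n m).length) : (word n m).get i =
    if (i : ℕ) = 0 then r18₁ else if (i : ℕ) ≤ n then r18₂ else r18₃ := by
  have h : (word n m)[(i : ℕ)]? = some ((word n m).get i) := by simp
  have hi : (i : ℕ) < n + m + 1 := length_word (n := n) (m := m) ▸ i.2
  rw [word_getElem?] at h
  grind

theorem wTime_word_of_le {i : ℕ} (hi : i ≤ n + 1) : wTime π18 (word n m) i = i := by
  induction i with
  | zero => simp [wTime]
  | succ i ih =>
    rw [wTime, Finset.sum_range_succ, ← wTime, ih (by omega), word_getElem?]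
    by_cases h0 : i = 0
    · simp [h0, idbShift_r18₁]
    · simp [h0, show i ≤ n by omega, idbShift_r18₂]

theorem wTime_word_add {j : ℕ} (hj : j ≤ m) :
    wTime π18 (word n m) (n + 1 + j) = n + 1 - j := by
  induction j with
  | zero => simpa using wTime_word_of_le (n := n) (m := m) le_rfl
  | succ j ih =>
    rw [← add_assoc, wTime, Finset.sum_range_succ, ← wTime, ih (by omega), word_getElem?,
      if_neg (by omega), if_neg (by omega), if_pos (by omega)]
    simp [idbShift_r18₃]
    ring

theorem isVerticalR_word_get (i : Fin (word n m).length) :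
    IsVerticalR π18 ((word n m).get i) ↔ n < i := by
  rw [word_get]
  split_ifs with h0 hn
  · simp [not_isVerticalR_r18₁, h0]
  · simp [not_isVerticalR_r18₂, hn]
  · simp [isVerticalR_r18₃, not_le.1 hn]

theorem wSpine_word {i : ℕ} (hi : i ≤ n + m + 1) : wSpine π18 (word n m) i = i - n - 1 := by
  have himage : Fin.val '' {j : Fin (word n m).length |
      (j : ℕ) < i ∧ IsVerticalR π18 ((word n m).get j)} = (Finset.Ioo n i : Finset ℕ) := by
    ext k
    simp only [isVerticalR_word_get, Set.mem_image, Set.mem_ofPred_eq, Finset.coe_Ioo, Set.mem_Ioo]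
    constructor
    · rintro ⟨j, h, rfl⟩
      exact h.symm
    · rintro ⟨h₁, h₂⟩
      exact ⟨⟨k, by rw [length_word]; omega⟩, ⟨h₂, h₁⟩, rfl⟩
  rw [wSpine, ← Set.ncard_image_of_injective _ Fin.val_injective, himage, Set.ncard_coe_finset,
    Nat.card_Ioo]

/-- The spine variable `X_j`. -/
def spine (j : ℕ) : WV := Sum.inl j

theorem A_mem_wSlice :
    (⟨R18.A, fun _ => spine 0⟩ : Atom S18 WV) ∈ wSlice π18 (word n m) 0 := by
  refine ⟨⟨0, by simp [word]⟩, ⟨[], R18.A, ![0]⟩, List.mem_cons_self, A_notMem_IDB, ?_, ?_⟩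
  · simp [wTime, netShift]
  · refine congrArg (Sigma.mk (β := fun P : S18.Rel => Fin (S18.arity P) → WV) R18.A) ?_
    funext z
    have hz : (![0] : Fin 1 → ℕ) z = 0 := congrArg ![0] (Subsingleton.elim (α := Fin 1) z 0)
    change _ = wRen π18 (word n m) 0 r18₁ ((![0] : Fin 1 → ℕ) z)
    rw [hz]
    refine ((if_pos ⟨(0 : Fin 1), rfl⟩).trans ?_).symm
    rw [wSpine_word (by omega), Nat.zero_sub, Nat.zero_sub]
    rfl

theorem wRen_word_zero {j : ℕ} (hj : j < m) :
    wRen π18 (word n m) (n + 1 + j) r18₃ 0 = spine j := by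
  refine (if_pos ⟨(0 : Fin 1), rfl⟩).trans ?_
  exact congrArg spine ((wSpine_word (by omega)).trans (by omega))

theorem wRen_word_one {j : ℕ} (hj : j < m) :
    wRen π18 (word n m) (n + 1 + j) r18₃ 1 = spine (j + 1) := by
  refine (if_neg (by rintro ⟨_, h⟩; exact zero_ne_one (α := ℕ) h)).trans ?_
  refine (if_pos ⟨_, (recDecomp_r18₃_iff _).2 rfl, (0 : Fin 1), rfl⟩).trans ?_
  exact congrArg spine ((wSpine_word (by omega)).trans (by omega))

theorem mem_wSlice_of_mem_r18₃_body {j : ℕ} (hj : j < m) {q : PAtom S18 ℕ}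
    (hq : q ∈ r18₃.body) (hI : q.R ∉ π18.IDB) :
    (⟨q.R, fun z => wRen π18 (word n m) (n + 1 + j) r18₃ (q.args z)⟩ : Atom S18 WV) ∈
      wSlice π18 (word n m) (n + 1 - j + netShift q.ops) := by
  have hget : (word n m).get ⟨n + 1 + j, by rw [length_word]; omega⟩ = r18₃ := by
    rw [word_get, if_neg (by simp), if_neg (by simp; omega)]
  refine ⟨⟨n + 1 + j, by rw [length_word]; omega⟩, q, ?_, hI, ?_, ?_⟩
  · rwa [hget]
  · rw [wTime_word_add (by omega)]
  · rw [hget]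

theorem R_mem_wSlice {j : ℕ} (hj : j < m) :
    (⟨R18.R, ![spine j, spine (j + 1)]⟩ : Atom S18 WV) ∈
      wSlice π18 (word n m) (n + 1 - j) := by
  have h := mem_wSlice_of_mem_r18₃_body (n := n) hj (q := ⟨[], R18.R, ![0, 1]⟩)
    (by simp [r18₃]) R_notMem_IDB
  simp only [netShift, List.map_nil, List.sum_nil, add_zero] at h
  convert h using 1
  refine congrArg (Sigma.mk (β := fun P : S18.Rel => Fin (S18.arity P) → WV) R18.R) ?_
  change (![spine j, spine (j + 1)] : Fin 2 → WV) =
    fun z : Fin 2 => wRen π18 (word n m) (n + 1 + j) r18₃ ((![0, 1] : Fin 2 → ℕ) z)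
  funext z
  fin_cases z
  · exact (wRen_word_zero hj).symm
  · exact (wRen_word_one hj).symm

theorem B_mem_wSlice {j : ℕ} (hj : j < m) :
    (⟨R18.B, fun _ => spine (j + 1)⟩ : Atom S18 WV) ∈ wSlice π18 (word n m) (n - j) := by
  have h := mem_wSlice_of_mem_r18₃_body (n := n) hj (q := ⟨[TOp.oprev], R18.B, ![1]⟩)
    (by simp [r18₃]) B_notMem_IDB
  have ht : (n + 1 - j + netShift [TOp.oprev] : ℤ) = n - j := by
    simp [netShift, TOp.shift]; ring
  rw [ht] at h
  convert h using 1
  refine congrArg (Sigma.mk (β := fun P : S18.Rel => Fin (S18.arity P) → WV) R18.B) ?_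
  change (fun _ : Fin 1 => spine (j + 1)) =
    fun z : Fin 1 => wRen π18 (word n m) (n + 1 + j) r18₃ ((![1] : Fin 1 → ℕ) z)
  funext z
  fin_cases z
  exact (wRen_word_one hj).symm

theorem spine_mem_wΔ {j : ℕ} (hj : j ≤ m) : spine j ∈ wΔ π18 (word n m) := by
  rcases j with _ | j
  · exact ⟨_, _, A_mem_wSlice, (0 : Fin 1), rfl⟩
  · exact ⟨_, _, B_mem_wSlice (Nat.lt_of_succ_le hj), (0 : Fin 1), rfl⟩

theorem eq_zero_of_A_mem_wSlice {t : ℤ} {f : Fin 1 → WV}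
    (h : (⟨R18.A, f⟩ : Atom S18 WV) ∈ wSlice π18 (word n m) t) : t = 0 := by
  obtain ⟨i, q, hq, -, rfl, ha⟩ := h
  have hR : (R18.A : S18.Rel) = q.R := congrArg Sigma.fst ha
  rw [word_get] at hq
  split_ifs at hq with h0 hn <;>
    simp only [r18₁, r18₂, r18₃, List.mem_cons, List.not_mem_nil, or_false] at hq
  · rcases hq with rfl | rfl
    · simp [h0, wTime, netShift]
    · cases hR
  · subst hq
    cases hR
  · rcases hq with rfl | rfl | rfl <;> cases hR

theorem exists_of_B_mem_wSlice {t : ℤ} {f : Fin 1 → WV}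
    (h : (⟨R18.B, f⟩ : Atom S18 WV) ∈ wSlice π18 (word n m) t) : ∃ j < m, t = n - j := by
  obtain ⟨i, q, hq, -, rfl, ha⟩ := h
  have hR : (R18.B : S18.Rel) = q.R := congrArg Sigma.fst ha
  have hi : (i : ℕ) < n + m + 1 := length_word (n := n) (m := m) ▸ i.2
  rw [word_get] at hq
  split_ifs at hq with h0 hn <;>
    simp only [r18₁, r18₂, r18₃, List.mem_cons, List.not_mem_nil, or_false] at hq
  · rcases hq with rfl | rfl <;> cases hR
  · subst hq
    cases hR
  · rcases hq with rfl | rfl | rfl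
    · cases hR
    · obtain ⟨j, hj⟩ := Nat.exists_eq_add_of_le (show n + 1 ≤ i by omega)
      refine ⟨j, by omega, ?_⟩
      rw [hj, wTime_word_add (by omega)]
      simp [netShift, TOp.shift]
      ring
    · cases hR

section Rules

variable {Δ : Set WV} {E : ℤ → Set (Atom S18 WV)} {ℓ : ℤ} {x y : WV}

theorem satRule_r18₁ (h : SatRule Δ E r18₁) (hx : x ∈ Δ)
    (hA : (⟨R18.A, fun _ => x⟩ : Atom S18 WV) ∈ E ℓ)
    (hD : (⟨R18.D, fun _ => x⟩ : Atom S18 WV) ∈ E (ℓ + 1)) :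
    (⟨R18.G, fun _ => x⟩ : Atom S18 WV) ∈ E ℓ := by
  refine h (fun _ => x) (fun _ => hx) ℓ fun p hp => ?_
  simp only [r18₁, List.mem_cons, List.not_mem_nil, or_false] at hp
  rcases hp with rfl | rfl
  exacts [hA, hD]

theorem satRule_r18₂ (h : SatRule Δ E r18₂) (hx : x ∈ Δ)
    (hD : (⟨R18.D, fun _ => x⟩ : Atom S18 WV) ∈ E (ℓ + 1)) :
    (⟨R18.D, fun _ => x⟩ : Atom S18 WV) ∈ E ℓ := by
  refine h (fun _ => x) (fun _ => hx) ℓ fun p hp => ?_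
  simp only [r18₂, List.mem_cons, List.not_mem_nil, or_false] at hp
  rcases hp with rfl
  exact hD

/-- The assignment sending variable `0` to `x` and all others to `y`. -/
def pairAssign (x y : WV) (v : ℕ) : WV := if v = 0 then x else y

theorem pairAssign_mem (hx : x ∈ Δ) (hy : y ∈ Δ) (v : ℕ) : pairAssign x y v ∈ Δ := by
  unfold pairAssign
  split_ifs <;> assumption

theorem sat_of_satOps {ν : ℕ → WV} {ops : List TOp} {P : S18.Rel}
    {args : Fin (S18.arity P) → ℕ} (hargs : ∀ i, ν (args i) = x)
    (h : satOps E ⟨P, fun _ => x⟩ ops ℓ) : PAtom.sat E ν ℓ ⟨ops, P, args⟩ := by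
  rwa [← funext hargs] at h

theorem satRule_r18₃ (h : SatRule Δ E r18₃) (hx : x ∈ Δ) (hy : y ∈ Δ)
    (hR : (⟨R18.R, ![x, y]⟩ : Atom S18 WV) ∈ E ℓ)
    (hB : (⟨R18.B, fun _ => y⟩ : Atom S18 WV) ∈ E (ℓ - 1))
    (hD : (⟨R18.D, fun _ => y⟩ : Atom S18 WV) ∈ E (ℓ - 1)) :
    (⟨R18.D, fun _ => x⟩ : Atom S18 WV) ∈ E ℓ := by
  have hu (i : Fin 1) : pairAssign x y (![1] i) = y := by fin_cases i; rfl
  refine h (pairAssign x y) (pairAssign_mem hx hy) ℓ fun p hp => ?_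
  simp only [r18₃, List.mem_cons, List.not_mem_nil, or_false] at hp
  rcases hp with rfl | rfl | rfl
  · have : (![x, y] : Fin 2 → WV) = fun i => pairAssign x y ((![0, 1] : Fin 2 → ℕ) i) := by
      funext i
      fin_cases i <;> rfl
    rw [this] at hR
    exact hR
  · exact sat_of_satOps (P := R18.B) hu hB
  · exact sat_of_satOps (P := R18.D) hu hD

theorem satRule_r18₄ (h : SatRule Δ E r18₄) (hx : x ∈ Δ) (hy : y ∈ Δ)
    (hA : (⟨R18.A, fun _ => y⟩ : Atom S18 WV) ∈ E ℓ)
    (hB : (⟨R18.B, fun _ => x⟩ : Atom S18 WV) ∈ E ℓ) :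
    (⟨R18.D, fun _ => x⟩ : Atom S18 WV) ∈ E ℓ := by
  have hu₀ (i : Fin 1) : pairAssign x y (![0] i) = x := by fin_cases i; rfl
  have hu₁ (i : Fin 1) : pairAssign x y (![1] i) = y := by fin_cases i; rfl
  refine h (pairAssign x y) (pairAssign_mem hx hy) ℓ fun p hp => ?_
  simp only [r18₄, List.mem_cons, List.not_mem_nil, or_false] at hp
  rcases hp with rfl | rfl
  · exact sat_of_satOps (P := R18.A) hu₁ hA
  · exact sat_of_satOps (P := R18.B) hu₀ hB

end Rules

theorem wAccept_of_lt (h : n < m) : wAccept π18 R18.G (word n m) := by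
  rintro E ⟨⟨hI, -, -⟩, hrules⟩
  have h₁ := hrules r18₁ (by simp [π18])
  have h₂ := hrules r18₂ (by simp [π18])
  have h₃ := hrules r18₃ (by simp [π18])
  have h₄ := hrules r18₄ (by simp [π18])
  have climb : ∀ k ≤ n + 1,
      (⟨R18.D, fun _ => spine (n + 1 - k)⟩ : Atom S18 WV) ∈ E (k : ℤ) := by
    intro k hk
    induction k with
    | zero =>
      refine satRule_r18₄ h₄ (spine_mem_wΔ (by omega)) (spine_mem_wΔ (Nat.zero_le m))
        (hI _ _ A_mem_wSlice) (hI _ _ ?_)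
      have hB := B_mem_wSlice (n := n) h
      rw [sub_self] at hB
      exact hB
    | succ k ih =>
      obtain ⟨j, rfl⟩ := Nat.exists_eq_add_of_le (show k ≤ n by omega)
      have ih := ih (by omega)
      rw [show k + j + 1 - k = j + 1 by omega] at ih
      rw [show k + j + 1 - (k + 1) = j by omega]
      have hj : j < m := by omega
      have hR := R_mem_wSlice (n := k + j) hj
      have hB := B_mem_wSlice (n := k + j) hj
      rw [show ((k + j : ℕ) + 1 - j : ℤ) = (k + 1 : ℕ) by push_cast; ring] at hR
      rw [show ((k + j : ℕ) - j : ℤ) = (k + 1 : ℕ) - 1 by push_cast; ring] at hB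
      refine satRule_r18₃ h₃ (spine_mem_wΔ hj.le) (spine_mem_wΔ hj) (hI _ _ hR) (hI _ _ hB) ?_
      simpa using ih
  have descend : ∀ k ≤ n, (⟨R18.D, fun _ => spine 0⟩ : Atom S18 WV) ∈ E (n + 1 - k : ℤ) := by
    intro k hk
    induction k with
    | zero => simpa using climb (n + 1) le_rfl
    | succ k ih =>
      refine satRule_r18₂ h₂ (spine_mem_wΔ (Nat.zero_le m)) ?_
      convert ih (by omega) using 2
      push_cast
      ring
  refine satRule_r18₁ h₁ (spine_mem_wΔ (Nat.zero_le m)) (hI _ _ A_mem_wSlice) ?_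
  rw [show (0 + 1 : ℤ) = n + 1 - n by ring]
  exact descend n le_rfl

theorem not_IDB_of_mem_wSlice {w : List (Rule S18)} {t : ℤ} {a : Atom S18 WV}
    (h : a ∈ wSlice π18 w t) : a.1 ∉ π18.IDB := by
  obtain ⟨i, q, -, hI, -, rfl⟩ := h
  exact hI

theorem isModel_wSlice (h : m ≤ n) :
    IsModel π18 (wΔ π18 (word n m)) (wSlice π18 (word n m)) (wSlice π18 (word n m)) := by
  refine ⟨⟨fun _ _ h => h, fun _ _ h _ => h, fun t a ha i => ⟨t, a, ha, i, rfl⟩⟩, ?_⟩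
  intro r hr ν _ ℓ hbody
  exfalso
  simp only [π18, List.mem_cons, List.not_mem_nil, or_false] at hr
  rcases hr with rfl | rfl | rfl | rfl
  · exact not_IDB_of_mem_wSlice (hbody ⟨[TOp.onext], R18.D, ![0]⟩ (by simp [r18₁])) D_mem_IDB
  · exact not_IDB_of_mem_wSlice (hbody ⟨[TOp.onext], R18.D, ![0]⟩ (by simp [r18₂])) D_mem_IDB
  · exact not_IDB_of_mem_wSlice (hbody ⟨[TOp.oprev], R18.D, ![1]⟩ (by simp [r18₃])) D_mem_IDB
  · have hA := eq_zero_of_A_mem_wSlice (hbody ⟨[], R18.A, ![1]⟩ (by simp [r18₄]))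
    obtain ⟨j, hj, ht⟩ := exists_of_B_mem_wSlice (hbody ⟨[], R18.B, ![0]⟩ (by simp [r18₄]))
    omega

theorem wAccept_word_iff : wAccept π18 R18.G (word n m) ↔ n < m := by
  refine ⟨fun h => ?_, wAccept_of_lt⟩
  by_contra hnm
  exact not_IDB_of_mem_wSlice (h _ (isModel_wSlice (not_lt.1 hnm)))
    ((mem_IDB_iff _).2 (Or.inl rfl))

theorem not_isRegularLang : ¬ IsRegularLang {w : List (Rule S18) | wAccept π18 R18.G w} := by
  rintro ⟨Q, _, M, hM⟩
  obtain ⟨n, k, hne, heq⟩ := Finite.exists_ne_map_eq_of_infinite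
    fun n : ℕ => M.eval (r18₁ :: List.replicate n r18₂)
  have hlt (n m : ℕ) : word n m ∈ M.accepts ↔ n < m := (hM _).trans wAccept_word_iff
  have heval (n m : ℕ) : M.eval (word n m) =
      M.evalFrom (M.eval (r18₁ :: List.replicate n r18₂)) (List.replicate m r18₃) :=
    M.evalFrom_of_append _ (r18₁ :: List.replicate n r18₂) _
  have hiff (m : ℕ) : n < m ↔ k < m := by
    rw [← hlt, ← hlt, DFA.mem_accepts, DFA.mem_accepts, heval, heval, heq]
  have h₁ := hiff (n + 1)
  have h₂ := hiff (k + 1)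
  omega

end Statement18

/-- For all `n, m ≥ 1`: `B₁B₂ⁿB₃^m ∈ accept(π, G)` iff
`m > n`; consequently `accept(π, G)` is not regular. -/
theorem statement18 :
    (∀ n m : ℕ, 1 ≤ n → 1 ≤ m →
      (wAccept π18 R18.G (r18₁ :: (List.replicate n r18₂ ++ List.replicate m r18₃)) ↔
        m > n)) ∧
    ¬ IsRegularLang {w : List (Rule S18) | wAccept π18 R18.G w} := by
  exact ⟨fun _ _ _ _ => Statement18.wAccept_word_iff, Statement18.not_isRegularLang⟩
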